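/- arXiv:2604.24777 — 5 statements merged into one kernel-verified Lean document; each statement's English description precedes it below -/
import Mathlib

section
/- Let b > 0, let I be a nonempty finite index set, let n be a positive natural number, and let E_i : I → ℝ and E_f : I → ℝ be two energy assignments with E_i(k) < 1/b and E_f(k) < 1/b for all k ∈ I. Define the discrete partition functions Z_i = ∑_{k∈I} (1 - b·E_i(k))^n and Z_f = ∑_{k∈I} (1 - b·E_f(k))^n. Let Φ : I → I be a bijection, and let the initial probability of state k be p(k) = (1 - b·E_i(k))^n / Z_i. Then the average of the discrete work functional W_d(k) = ((1 - b·E_f(Φ(k))) / (1 - b·E_i(k)))^n satisfies ∑_{k∈I} p(k)·W_d(k) = Z_f / Z_i. -/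
open Finset

/-- Exact discrete Jarzynski identity for deterministic bijective protocols:
the discrete-Gibbs average of the discrete work functional
`W_d(k) = ((1 - b·E_f(Φ k))/(1 - b·E_i k))^n` equals `Z_f / Z_i`. -/
theorem discrete_jarzynski
    (b : ℝ) (hb : 0 < b)
    (I : Type) [Fintype I] [Nonempty I]
    (n : ℕ) (hn : 0 < n)
    (Ei Ef : I → ℝ)
    (hEi : ∀ k, Ei k < 1 / b) (hEf : ∀ k, Ef k < 1 / b)
    (Φ : I → I) (hΦ : Function.Bijective Φ) :
    (∑ k : I,
        ((1 - b * Ei k) ^ n / (∑ j : I, (1 - b * Ei j) ^ n)) *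
          ((1 - b * Ef (Φ k)) / (1 - b * Ei k)) ^ n)
      = (∑ j : I, (1 - b * Ef j) ^ n) / (∑ j : I, (1 - b * Ei j) ^ n) := by
  have hpos (k : I) : 0 < 1 - b * Ei k := by
    have := (lt_div_iff₀' hb).mp (hEi k)
    linarith
  rw [← hΦ.sum_comp (fun j => (1 - b * Ef j) ^ n), Finset.sum_div]
  refine Finset.sum_congr rfl fun k _ => ?_
  rw [div_pow, div_mul_div_comm, mul_comm (∑ j : I, _),
    mul_div_mul_left _ _ (pow_pos (hpos k) n).ne']
end

section
/- For every b > 0 and every positive natural number n, there exist real numbers E₁, E₁', E₂, E₂' with 0 ≤ E₁ < 1/b, 0 ≤ E₁' < 1/b, 0 ≤ E₂ < 1/b, 0 ≤ E₂' < 1/b, such that the work values agree, E₁' − E₁ = E₂' − E₂, but the path-weight ratios disagree: ((1 − b·E₁)/(1 − b·E₁'))^n ≠ ((1 − b·E₂)/(1 − b·E₂'))^n. Hence at finite b the discrete Crooks path-weight ratio is not a function of the work alone. -/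
/-- No work-only Crooks relation at finite `b`: for every `b > 0` and `n ≥ 1`
there are two admissible trajectories with the same work but different
discrete path-weight ratios. -/
theorem no_work_only_crooks
    (b : ℝ) (hb : 0 < b) (n : ℕ) (hn : 0 < n) :
    ∃ E₁ E₁' E₂ E₂' : ℝ,
      0 ≤ E₁ ∧ E₁ < 1 / b ∧
      0 ≤ E₁' ∧ E₁' < 1 / b ∧
      0 ≤ E₂ ∧ E₂ < 1 / b ∧
      0 ≤ E₂' ∧ E₂' < 1 / b ∧
      E₁' - E₁ = E₂' - E₂ ∧
      ((1 - b * E₁) / (1 - b * E₁')) ^ n ≠ ((1 - b * E₂) / (1 - b * E₂')) ^ n := by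
  have hb0 : b ≠ 0 := hb.ne'
  have hlt {c : ℝ} (hc : c < 1) : c / b < 1 / b := div_lt_div_of_pos_right hc hb
  refine ⟨0, (1 / 4) / b, (1 / 4) / b, (1 / 2) / b, le_rfl, by positivity, by positivity,
    hlt (by norm_num), by positivity, hlt (by norm_num), by positivity, hlt (by norm_num),
    by ring, ?_⟩
  rw [mul_zero, mul_div_cancel₀ _ hb0, mul_div_cancel₀ _ hb0]
  exact (pow_lt_pow_left₀ (by norm_num) (by norm_num) hn.ne').ne
end

section
/- Fix β > 0. For b > 0 with exponent β/b taken as a real power, define L(b) = ∫₀^{1/b} ω³/((1 − b·ω)^{−β/b} − 1) dω and L(0) = ∫₀^∞ ω³/(e^{β·ω} − 1) dω = π⁴/(15·β⁴). Then lim_{b → 0⁺} (L(b) − L(0))/b = −60·ζ(5)/β⁵. Equivalently, the discrete luminosity satisfies L(b) = L(0)·(1 − (900·ζ(5)/π⁴)·(b/β) + o(b)) as b → 0⁺. -/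
open Filter

open Filter MeasureTheory Set in
theorem integral_pow_mul_exp_neg_mul_Ioi (n : ℕ) {r : ℝ} (hr : 0 < r) :
    ∫ t in Ioi (0 : ℝ), t ^ n * Real.exp (-(r * t)) = n.factorial / r ^ (n + 1) := by
  have h := Real.integral_rpow_mul_exp_neg_mul_Ioi (a := (n : ℝ) + 1) (by positivity) hr
  rw [Real.Gamma_nat_eq_factorial] at h
  have h1 : (1 / r) ^ ((n : ℝ) + 1) = (1 / r) ^ (n + 1) := by
    rw [← Real.rpow_natCast]; push_cast; rfl
  simp only [add_sub_cancel_right, Real.rpow_natCast, h1] at h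
  rw [h, one_div, inv_pow]
  ring

open Filter MeasureTheory Set in
theorem integrableOn_pow_mul_exp_neg_mul_Ioi (n : ℕ) {r : ℝ} (hr : 0 < r) :
    IntegrableOn (fun t : ℝ => t ^ n * Real.exp (-(r * t))) (Ioi 0) := by
  refine not_imp_comm.1 integral_undef ?_
  rw [integral_pow_mul_exp_neg_mul_Ioi n hr]
  positivity

theorem hasSum_pow_mul_exp_neg_mul (n : ℕ) {β y : ℝ} (hβ : 0 < β) (hy : 0 < y) :
    HasSum (fun k : ℕ => y ^ n * Real.exp (-((k + 1) * β * y))) (y ^ n / (Real.exp (β * y) - 1)) := by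
  have hx : Real.exp (-(β * y)) < 1 := Real.exp_zero ▸ Real.exp_lt_exp.2 (by nlinarith [mul_pos hβ hy])
  have h := (hasSum_geometric_of_lt_one (Real.exp_pos _).le hx).mul_left
    (y ^ n * Real.exp (-(β * y)))
  have h1 : 1 < Real.exp (β * y) := Real.one_lt_exp_iff.2 (mul_pos hβ hy)
  have hterm (k : ℕ) : y ^ n * Real.exp (-((k + 1) * β * y)) =
      y ^ n * Real.exp (-(β * y)) * Real.exp (-(β * y)) ^ k := by
    rw [← Real.exp_nat_mul, mul_assoc (y ^ n), ← Real.exp_add]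
    ring_nf
  have hval : y ^ n / (Real.exp (β * y) - 1) =
      y ^ n * Real.exp (-(β * y)) * (1 - Real.exp (-(β * y)))⁻¹ := by
    have h2 : Real.exp (β * y) - 1 ≠ 0 := by linarith
    rw [Real.exp_neg]
    have h3 : 1 - (Real.exp (β * y))⁻¹ = (Real.exp (β * y) - 1) / Real.exp (β * y) := by
      field_simp
    rw [h3]
    field_simp
  simpa only [hterm, hval] using h

open Filter MeasureTheory Set in
/-- The Bose–Einstein integral as a Dirichlet series. -/
theorem integral_pow_div_exp_sub_one {n : ℕ} (hn : 1 ≤ n) {β : ℝ} (hβ : 0 < β) :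
    ∫ y in Ioi (0 : ℝ), y ^ n / (Real.exp (β * y) - 1) =
      n.factorial / β ^ (n + 1) * ∑' k : ℕ, 1 / (k : ℝ) ^ (n + 1) := by
  have hsum : Summable fun k : ℕ => 1 / (k : ℝ) ^ (n + 1) :=
    Real.summable_one_div_nat_pow.2 (by omega)
  have hr (k : ℕ) : 0 < ((k : ℝ) + 1) * β := by positivity
  have hval (k : ℕ) : (n.factorial : ℝ) / (((k : ℝ) + 1) * β) ^ (n + 1) =
      n.factorial / β ^ (n + 1) * (1 / ((k + 1 : ℕ) : ℝ) ^ (n + 1)) := by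
    push_cast
    rw [mul_pow]
    field_simp
  have hnorm (k : ℕ) : ∫ y in Ioi (0 : ℝ), ‖y ^ n * Real.exp (-((k + 1) * β * y))‖ =
      n.factorial / β ^ (n + 1) * (1 / ((k + 1 : ℕ) : ℝ) ^ (n + 1)) := by
    rw [← hval, ← integral_pow_mul_exp_neg_mul_Ioi n (hr k)]
    refine setIntegral_congr_fun measurableSet_Ioi fun y (hy : 0 < y) => ?_
    exact Real.norm_of_nonneg (by positivity)
  have h := hasSum_integral_of_summable_integral_norm
    (F := fun (k : ℕ) (y : ℝ) => y ^ n * Real.exp (-((k + 1) * β * y)))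
    (μ := volume.restrict (Ioi 0)) (fun k => integrableOn_pow_mul_exp_neg_mul_Ioi n (hr k))
    (by simp only [hnorm]; exact ((summable_nat_add_iff 1).2 hsum).mul_left _)
  have htsum : ∫ y in Ioi (0 : ℝ), ∑' k : ℕ, y ^ n * Real.exp (-((k + 1) * β * y)) =
      ∫ y in Ioi (0 : ℝ), y ^ n / (Real.exp (β * y) - 1) :=
    setIntegral_congr_fun measurableSet_Ioi fun y hy =>
      (hasSum_pow_mul_exp_neg_mul n hβ hy).tsum_eq
  rw [htsum] at h
  simp only [integral_pow_mul_exp_neg_mul_Ioi n (hr _), hval] at h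
  rw [← h.tsum_eq, tsum_mul_left, hsum.tsum_eq_zero_add]
  simp

open Filter MeasureTheory Set in
theorem integrableOn_pow_div_exp_sub_one {n : ℕ} (hn : 1 ≤ n) {β : ℝ} (hβ : 0 < β) :
    IntegrableOn (fun y : ℝ => y ^ n / (Real.exp (β * y) - 1)) (Ioi 0) := by
  refine not_imp_comm.1 integral_undef ?_
  rw [integral_pow_div_exp_sub_one hn hβ]
  have hsum : Summable fun k : ℕ => 1 / (k : ℝ) ^ (n + 1) :=
    Real.summable_one_div_nat_pow.2 (by omega)
  have : 0 < ∑' k : ℕ, 1 / (k : ℝ) ^ (n + 1) :=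
    hsum.tsum_pos (fun k => by positivity) 1 (by simp)
  positivity

theorem re_riemannZeta_natCast {k : ℕ} (hk : 1 < k) :
    (riemannZeta k).re = ∑' n : ℕ, 1 / (n : ℝ) ^ k := by
  rw [zeta_nat_eq_tsum_of_gt_one hk,
    show ∑' n : ℕ, 1 / (n : ℂ) ^ k = ((∑' n : ℕ, 1 / (n : ℝ) ^ k : ℝ) : ℂ) by push_cast; rfl,
    Complex.ofReal_re]

theorem exp_neg_le_quadratic {t : ℝ} (ht : 0 ≤ t) : Real.exp (-t) ≤ 1 - t + t ^ 2 / 2 := by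
  have h := Real.quadratic_le_exp_of_nonneg ht
  rw [Real.exp_neg]
  refine inv_le_of_inv_le₀ (by nlinarith [sq_nonneg (t - 1)]) (le_trans ?_ h)
  rw [inv_le_iff_one_le_mul₀ (by nlinarith [sq_nonneg (t - 1)])]
  nlinarith [sq_nonneg (t ^ 2)]

theorem cube_one_sub_exp_neg_mul_exp_neg_le {t : ℝ} (ht : 0 ≤ t) :
    (1 - Real.exp (-t)) ^ 3 * Real.exp (-t) ≤ t ^ 3 := by
  have h1 : Real.exp (-t) ≤ 1 := Real.exp_le_one_iff.2 (by linarith)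
  have h2 := Real.add_one_le_exp (-t)
  have h3 : (1 - Real.exp (-t)) ^ 3 ≤ t ^ 3 :=
    pow_le_pow_left₀ (by linarith) (by linarith) 3
  exact (mul_le_of_le_one_right (pow_nonneg (by linarith) 3) h1).trans h3

theorem le_cube_one_sub_exp_neg_mul_exp_neg {t : ℝ} (ht : 0 ≤ t) :
    t ^ 3 - 5 / 2 * t ^ 4 ≤ (1 - Real.exp (-t)) ^ 3 * Real.exp (-t) := by
  have h1 : Real.exp (-t) ≤ 1 := Real.exp_le_one_iff.2 (by linarith)
  have h2 := Real.add_one_le_exp (-t)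
  have h3 := exp_neg_le_quadratic ht
  rcases le_total (2 / 5) t with h | h
  · have h4 : 0 ≤ (1 - Real.exp (-t)) ^ 3 * Real.exp (-t) :=
      mul_nonneg (pow_nonneg (by linarith) 3) (Real.exp_pos _).le
    have h5 : 0 ≤ t ^ 3 * (5 / 2 * t - 1) := mul_nonneg (by positivity) (by linarith)
    nlinarith
  · have hu : (t * (1 - t / 2)) ^ 3 ≤ (1 - Real.exp (-t)) ^ 3 :=
      pow_le_pow_left₀ (mul_nonneg ht (by linarith)) (by nlinarith) 3
    have hs : 1 - 3 / 2 * t ≤ (1 - t / 2) ^ 3 := by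
      nlinarith [mul_nonneg (sq_nonneg t) (by linarith : 0 ≤ 6 - t)]
    calc t ^ 3 - 5 / 2 * t ^ 4 ≤ t ^ 3 * ((1 - 3 / 2 * t) * (1 - t)) := by
          nlinarith [pow_nonneg ht 5]
      _ ≤ t ^ 3 * ((1 - t / 2) ^ 3 * (1 - t)) := by
          gcongr
          linarith
      _ = (t * (1 - t / 2)) ^ 3 * (1 - t) := by ring
      _ ≤ _ := mul_le_mul hu (by linarith) (by linarith) (pow_nonneg (by linarith) 3)

theorem cube_one_sub_exp_neg_mul_exp_neg_le_of_le_one {t : ℝ} (ht : 0 ≤ t) (ht1 : t ≤ 1) :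
    (1 - Real.exp (-t)) ^ 3 * Real.exp (-t) ≤ t ^ 3 - 5 / 2 * t ^ 4 + 10 * t ^ 5 := by
  have h1 : Real.exp (-t) ≤ 1 := Real.exp_le_one_iff.2 (by linarith)
  have h3 := exp_neg_le_quadratic ht
  have h4 : 1 - Real.exp (-t) ≤ t * (1 - t / 2 + t ^ 2 / 4) := by
    have h := (abs_le.1 (Real.exp_bound (x := -t) (by rwa [abs_neg, abs_of_nonneg ht])
      (n := 3) (by norm_num))).1
    simp [Finset.sum_range_succ, Nat.factorial, abs_of_nonneg ht] at h
    nlinarith [pow_nonneg ht 3]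
  have hp : 0 ≤ 1 - t / 2 + t ^ 2 / 4 := by nlinarith [sq_nonneg t]
  have hq : 0 ≤ 1 - t + t ^ 2 / 2 := by nlinarith [sq_nonneg t]
  have ht2 : t ^ 2 ≤ t := by nlinarith
  have ht3 : t ^ 3 ≤ t ^ 2 := pow_le_pow_of_le_one ht ht1 (by norm_num)
  have ht4 : t ^ 4 ≤ t ^ 2 := pow_le_pow_of_le_one ht ht1 (by norm_num)
  have ht30 := pow_nonneg ht 3
  have hp2 : (1 - t / 2 + t ^ 2 / 4) ^ 2 ≤ 1 - t + t ^ 2 := by nlinarith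
  have hp3 : (1 - t / 2 + t ^ 2 / 4) ^ 3 ≤ 1 - 3 / 2 * t + 3 * t ^ 2 := by
    have := mul_le_mul_of_nonneg_right hp2 hp
    nlinarith
  have hpq : (1 - t / 2 + t ^ 2 / 4) ^ 3 * (1 - t + t ^ 2 / 2) ≤ 1 - 5 / 2 * t + 10 * t ^ 2 := by
    have := mul_le_mul_of_nonneg_right hp3 hq
    nlinarith
  calc (1 - Real.exp (-t)) ^ 3 * Real.exp (-t)
      ≤ (t * (1 - t / 2 + t ^ 2 / 4)) ^ 3 * (1 - t + t ^ 2 / 2) :=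
        mul_le_mul (pow_le_pow_left₀ (by linarith) h4 3) h3 (Real.exp_pos _).le
          (pow_nonneg (mul_nonneg ht hp) 3)
    _ = t ^ 3 * ((1 - t / 2 + t ^ 2 / 4) ^ 3 * (1 - t + t ^ 2 / 2)) := by ring
    _ ≤ t ^ 3 * (1 - 5 / 2 * t + 10 * t ^ 2) := mul_le_mul_of_nonneg_left hpq ht30
    _ = _ := by ring

open Set in
theorem image_one_sub_exp_neg_mul_div {b : ℝ} (hb : 0 < b) :
    (fun y : ℝ => (1 - Real.exp (-(b * y))) / b) '' Ioi 0 = Ioo 0 (1 / b) := by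
  ext ω
  constructor
  · rintro ⟨y, hy, rfl⟩
    have hy' : 0 < b * y := mul_pos hb hy
    have h1 : Real.exp (-(b * y)) < 1 := Real.exp_zero ▸ Real.exp_lt_exp.2 (by linarith)
    refine ⟨div_pos (by linarith) hb, ?_⟩
    dsimp only
    gcongr
    linarith [Real.exp_pos (-(b * y))]
  · rintro ⟨h0, h1⟩
    have h2 : b * ω < 1 := by rwa [lt_div_iff₀ hb, mul_comm] at h1
    refine ⟨-Real.log (1 - b * ω) / b, ?_, ?_⟩
    · have := Real.log_neg (by linarith : 0 < 1 - b * ω) (by nlinarith [mul_pos hb h0])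
      exact div_pos (by linarith) hb
    · dsimp only
      rw [show -(b * (-Real.log (1 - b * ω) / b)) = Real.log (1 - b * ω) by field_simp,
        Real.exp_log (by linarith)]
      field_simp
      ring

open MeasureTheory Set in
/-- The substitution `ω = (1 - exp (-b y)) / b` turns the deformed occupation into the Bose–Einstein
one. -/
theorem integral_discrete_luminosity {b : ℝ} (hb : 0 < b) (β : ℝ) :
    ∫ ω in (0 : ℝ)..(1 / b), ω ^ 3 / ((1 - b * ω) ^ (-(β / b)) - 1) =
      ∫ y in Ioi (0 : ℝ), (1 - Real.exp (-(b * y))) ^ 3 * Real.exp (-(b * y)) / b ^ 3 /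
        (Real.exp (β * y) - 1) := by
  have hderiv (y : ℝ) : HasDerivAt (fun y : ℝ => (1 - Real.exp (-(b * y))) / b)
      (Real.exp (-(b * y))) y := by
    have h := ((((hasDerivAt_id y).const_mul b).neg.exp).const_sub 1).div_const b
    refine h.congr_deriv ?_
    field_simp
    rfl
  have hinj : InjOn (fun y : ℝ => (1 - Real.exp (-(b * y))) / b) (Ioi 0) := by
    intro x _ y _ h
    simpa [hb.ne', div_left_inj'] using h
  rw [intervalIntegral.integral_of_le (by positivity), integral_Ioc_eq_integral_Ioo,
    ← image_one_sub_exp_neg_mul_div hb, integral_image_eq_integral_abs_deriv_smul measurableSet_Ioi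
      (fun y _ => (hderiv y).hasDerivWithinAt) hinj]
  refine setIntegral_congr_fun measurableSet_Ioi fun y _ => ?_
  have h1 : 1 - b * ((1 - Real.exp (-(b * y))) / b) = Real.exp (-(b * y)) := by
    field_simp
    ring
  have h2 : Real.exp (-(b * y)) ^ (-(β / b)) = Real.exp (β * y) := by
    rw [← Real.exp_mul]
    congr 1
    field_simp
  simp only [h1, h2, abs_of_pos (Real.exp_pos _), smul_eq_mul]
  ring

open Filter MeasureTheory Set Topology in
theorem tendsto_discrete_luminosity_slope {β : ℝ} (hβ : 0 < β) :
    Tendsto (fun b : ℝ => ∫ y in Ioi (0 : ℝ),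
        ((1 - Real.exp (-(b * y))) ^ 3 * Real.exp (-(b * y)) / b ^ 3 - y ^ 3) / b /
          (Real.exp (β * y) - 1))
      (𝓝[>] 0) (𝓝 (∫ y in Ioi (0 : ℝ), -(5 / 2) * (y ^ 4 / (Real.exp (β * y) - 1)))) := by
  have hpos {y : ℝ} (hy : 0 < y) : 0 < Real.exp (β * y) - 1 := by
    linarith [Real.one_lt_exp_iff.2 (mul_pos hβ hy)]
  have hlower {b y : ℝ} (hb : 0 < b) (hy : 0 < y) : -(5 / 2) * y ^ 4 ≤
      ((1 - Real.exp (-(b * y))) ^ 3 * Real.exp (-(b * y)) / b ^ 3 - y ^ 3) / b := by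
    have h := le_cube_one_sub_exp_neg_mul_exp_neg (mul_pos hb hy).le
    rw [le_div_iff₀ hb, le_sub_iff_add_le, le_div_iff₀ (by positivity)]
    linarith
  have hupper {b y : ℝ} (hb : 0 < b) (hy : 0 < y) :
      ((1 - Real.exp (-(b * y))) ^ 3 * Real.exp (-(b * y)) / b ^ 3 - y ^ 3) / b ≤ 0 := by
    have h := cube_one_sub_exp_neg_mul_exp_neg_le (mul_pos hb hy).le
    rw [div_le_iff₀ hb, sub_le_iff_le_add, div_le_iff₀ (by positivity)]
    linarith
  have hupper' {b y : ℝ} (hb : 0 < b) (hy : 0 < y) (hby : b * y ≤ 1) :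
      ((1 - Real.exp (-(b * y))) ^ 3 * Real.exp (-(b * y)) / b ^ 3 - y ^ 3) / b ≤
        -(5 / 2) * y ^ 4 + 10 * b * y ^ 5 := by
    have h := cube_one_sub_exp_neg_mul_exp_neg_le_of_le_one (mul_pos hb hy).le hby
    rw [div_le_iff₀ hb, sub_le_iff_le_add, div_le_iff₀ (by positivity)]
    linarith
  refine tendsto_integral_filter_of_dominated_convergence
    (fun y => 5 / 2 * (y ^ 4 / (Real.exp (β * y) - 1))) ?_ ?_ ?_ ?_
  · exact .of_forall fun b => Measurable.aestronglyMeasurable (by fun_prop)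
  · filter_upwards [self_mem_nhdsWithin] with b hb
    filter_upwards [ae_restrict_mem measurableSet_Ioi] with y hy
    rw [norm_div, Real.norm_of_nonneg (hpos hy).le, ← mul_div_assoc]
    gcongr
    · exact (hpos hy).le
    · rw [Real.norm_of_nonpos (hupper hb hy)]
      linarith [hlower hb hy]
  · exact (integrableOn_pow_div_exp_sub_one (by norm_num) hβ).const_mul _
  · filter_upwards [ae_restrict_mem measurableSet_Ioi] with y hy
    rw [← mul_div_assoc]
    refine Tendsto.div_const ?_ _
    have hlim : Tendsto (fun b : ℝ => -(5 / 2) * y ^ 4 + 10 * b * y ^ 5) (𝓝[>] 0)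
        (𝓝 (-(5 / 2) * y ^ 4)) := by
      have h : Continuous fun b : ℝ => -(5 / 2) * y ^ 4 + 10 * b * y ^ 5 := by fun_prop
      simpa using (h.tendsto 0).mono_left nhdsWithin_le_nhds
    refine tendsto_of_tendsto_of_tendsto_of_le_of_le' tendsto_const_nhds hlim ?_ ?_
    · filter_upwards [self_mem_nhdsWithin] with b hb using hlower hb hy
    · filter_upwards [Ioo_mem_nhdsGT (one_div_pos.2 hy)] with b hb
      exact hupper' hb.1 hy ((lt_div_iff₀ hy).1 hb.2).le

open MeasureTheory Set in
theorem integrableOn_discrete_luminosity {β b : ℝ} (hβ : 0 < β) (hb : 0 < b) :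
    IntegrableOn (fun y : ℝ => (1 - Real.exp (-(b * y))) ^ 3 * Real.exp (-(b * y)) / b ^ 3 /
      (Real.exp (β * y) - 1)) (Ioi 0) := by
  refine (integrableOn_pow_div_exp_sub_one (n := 3) (by norm_num) hβ).mono'
    (Measurable.aestronglyMeasurable (by fun_prop)) ?_
  filter_upwards [ae_restrict_mem measurableSet_Ioi] with y (hy : 0 < y)
  have hpos : 0 < Real.exp (β * y) - 1 := by
    linarith [Real.one_lt_exp_iff.2 (mul_pos hβ hy)]
  have h1 : Real.exp (-(b * y)) ≤ 1 := Real.exp_le_one_iff.2 (by linarith [mul_pos hb hy])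
  have h2 : 0 ≤ 1 - Real.exp (-(b * y)) := by linarith
  rw [Real.norm_of_nonneg (by positivity)]
  gcongr
  rw [div_le_iff₀ (by positivity)]
  linarith [cube_one_sub_exp_neg_mul_exp_neg_le (mul_pos hb hy).le, mul_pow b y 3]

/-- Leading finite-`b` correction to the Stefan–Boltzmann luminosity:
with `L(b) = ∫₀^{1/b} ω³/((1 - bω)^{-β/b} - 1) dω` and
`L(0) = ∫₀^∞ ω³/(e^{βω} - 1) dω = π⁴/(15β⁴)`, one has
`(L(b) - L(0))/b → -60·ζ(5)/β⁵` as `b → 0⁺`. -/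
theorem discrete_luminosity_first_order
    (β : ℝ) (hβ : 0 < β) :
    (∫ ω in Set.Ioi (0 : ℝ), ω ^ 3 / (Real.exp (β * ω) - 1))
        = Real.pi ^ 4 / (15 * β ^ 4) ∧
    Tendsto
      (fun b : ℝ =>
        ((∫ ω in (0 : ℝ)..(1 / b), ω ^ 3 / ((1 - b * ω) ^ (-(β / b)) - 1)) -
            ∫ ω in Set.Ioi (0 : ℝ), ω ^ 3 / (Real.exp (β * ω) - 1)) / b)
      (nhdsWithin 0 (Set.Ioi 0))
      (nhds (-60 * (riemannZeta 5).re / β ^ 5)) := by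
  constructor
  · rw [integral_pow_div_exp_sub_one (by norm_num) hβ, hasSum_zeta_four.tsum_eq]
    norm_num [Nat.factorial]
    field_simp
    norm_num
  · have hlim := tendsto_discrete_luminosity_slope hβ
    have hzeta := re_riemannZeta_natCast (k := 5) (by norm_num)
    push_cast at hzeta
    rw [MeasureTheory.integral_const_mul, integral_pow_div_exp_sub_one (by norm_num) hβ,
      ← hzeta] at hlim
    have hval : -(5 / 2) * ((Nat.factorial 4 : ℝ) / β ^ (4 + 1) * (riemannZeta 5).re) =
        -60 * (riemannZeta 5).re / β ^ 5 := by
      norm_num [Nat.factorial]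
      ring
    rw [hval] at hlim
    refine hlim.congr' ?_
    filter_upwards [self_mem_nhdsWithin] with b hb
    rw [integral_discrete_luminosity hb,
      ← MeasureTheory.integral_sub (integrableOn_discrete_luminosity hβ hb)
        (integrableOn_pow_div_exp_sub_one (by norm_num) hβ), ← MeasureTheory.integral_div]
    congr 1 with y
    ring
end

section
/- Fix β > 0 and b > 0, with the exponent β/b taken as a real power. Then ∫₀^{1/b} ω³/((1 − b·ω)^{−β/b} − 1) dω < ∫₀^∞ ω³/(e^{β·ω} − 1) dω. That is, the discrete spectrum radiates strictly less integrated power than the Planckian spectrum at the same temperature, for every finite b. -/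
/-- The integrand `ω ^ 3 / (exp (β ω) - 1)` of the Planck spectrum is integrable on `(0, ∞)`. -/
theorem integrableOn_pow_three_div_exp_sub_one {β : ℝ} (hβ : 0 < β) :
    MeasureTheory.IntegrableOn (fun ω : ℝ => ω ^ 3 / (Real.exp (β * ω) - 1)) (Set.Ioi 0) := by
  have hdom : MeasureTheory.IntegrableOn
      (fun ω : ℝ => β⁻¹ * (ω ^ (2 : ℝ) * Real.exp (-(β / 2) * ω))) (Set.Ioi 0) := by
    have h := integrableOn_rpow_mul_exp_neg_mul_rpow (p := 1) (s := 2) (b := β / 2)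
      (by norm_num) one_pos (by positivity)
    simp only [Real.rpow_one] at h
    exact h.const_mul _
  refine hdom.mono' (Measurable.aestronglyMeasurable (by fun_prop)) ?_
  filter_upwards [MeasureTheory.ae_restrict_mem measurableSet_Ioi] with ω hω
  have hω : 0 < ω := hω
  have hx : 0 < β * ω := mul_pos hβ hω
  have hden : 0 < Real.exp (β * ω) - 1 := sub_pos.2 (Real.one_lt_exp_iff.2 hx)
  have hsinh : β * ω / 2 ≤ Real.sinh (β * ω / 2) := Real.self_le_sinh_iff.2 (by positivity)
  rw [Real.sinh_eq] at hsinh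
  have hinv : Real.exp (-(β * ω / 2)) * Real.exp (β * ω / 2) = 1 := by
    rw [← Real.exp_add]; simp
  have hsq : Real.exp (β * ω) = Real.exp (β * ω / 2) * Real.exp (β * ω / 2) := by
    rw [← Real.exp_add]; ring_nf
  have hlower : β * ω * Real.exp (β * ω / 2) ≤ Real.exp (β * ω) - 1 := by
    nlinarith [Real.exp_pos (β * ω / 2)]
  rw [Real.norm_of_nonneg (by positivity), div_le_iff₀ hden, Real.rpow_two,
    show -(β / 2) * ω = -(β * ω / 2) by ring]
  calc ω ^ 3 = β⁻¹ * (ω ^ 2 * Real.exp (-(β * ω / 2))) * (β * ω * Real.exp (β * ω / 2)) := by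
        field_simp
        rw [mul_comm ω β, hinv]
    _ ≤ _ := by gcongr

/-- The deformed Boltzmann factor dominates the exponential one. -/
theorem exp_mul_le_one_sub_rpow_neg {β b ω : ℝ} (hβ : 0 < β) (hb : 0 < b) (h : b * ω < 1) :
    Real.exp (β * ω) ≤ (1 - b * ω) ^ (-(β / b)) := by
  have hpos : 0 < 1 - b * ω := sub_pos.2 h
  rw [Real.rpow_def_of_pos hpos, Real.exp_le_exp]
  have hlog : Real.log (1 - b * ω) ≤ -(b * ω) := by
    linarith [Real.log_le_sub_one_of_pos hpos]
  calc β * ω = -(b * ω) * -(β / b) := by field_simp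
    _ ≤ _ := mul_le_mul_of_nonpos_right hlog (neg_nonpos.2 (by positivity))

/-- The discrete spectrum radiates strictly less integrated power than the
Planckian spectrum at the same temperature, for every finite `b > 0`. -/
theorem discrete_luminosity_lt_planck
    (β b : ℝ) (hβ : 0 < β) (hb : 0 < b) :
    (∫ ω in (0 : ℝ)..(1 / b), ω ^ 3 / ((1 - b * ω) ^ (-(β / b)) - 1))
      < ∫ ω in Set.Ioi (0 : ℝ), ω ^ 3 / (Real.exp (β * ω) - 1) := by
  have hb' : 0 < 1 / b := by positivity
  have hint := integrableOn_pow_three_div_exp_sub_one hβ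
  have hpos : ∀ ω : ℝ, 0 < ω → 0 < Real.exp (β * ω) - 1 := fun ω hω =>
    sub_pos.2 (Real.one_lt_exp_iff.2 (mul_pos hβ hω))
  have hIoc := hint.mono_set (Set.Ioc_subset_Ioi_self : Set.Ioc 0 (1 / b) ⊆ Set.Ioi 0)
  have hIoi := hint.mono_set (Set.Ioi_subset_Ioi hb'.le)
  have htail : 0 < ∫ ω in Set.Ioi (1 / b), ω ^ 3 / (Real.exp (β * ω) - 1) := by
    rw [MeasureTheory.setIntegral_pos_iff_support_of_nonneg_ae _ hIoi]
    · have hsub : Set.Ioi (1 / b) ⊆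
          Function.support (fun ω : ℝ => ω ^ 3 / (Real.exp (β * ω) - 1)) := fun ω hω =>
        (div_pos (pow_pos (hb'.trans hω) 3) (hpos ω (hb'.trans hω))).ne'
      rw [Set.inter_eq_self_of_subset_right hsub, Real.volume_Ioi]
      exact ENNReal.zero_lt_top
    · filter_upwards [MeasureTheory.ae_restrict_mem measurableSet_Ioi] with ω hω
      exact (div_pos (pow_pos (hb'.trans hω) 3) (hpos ω (hb'.trans hω))).le
  have hle : (∫ ω in Set.Ioc 0 (1 / b), ω ^ 3 / ((1 - b * ω) ^ (-(β / b)) - 1))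
      ≤ ∫ ω in Set.Ioc 0 (1 / b), ω ^ 3 / (Real.exp (β * ω) - 1) := by
    rw [MeasureTheory.integral_Ioc_eq_integral_Ioo, MeasureTheory.integral_Ioc_eq_integral_Ioo]
    have hfactor : ∀ ω ∈ Set.Ioo 0 (1 / b),
        Real.exp (β * ω) - 1 ≤ (1 - b * ω) ^ (-(β / b)) - 1 := fun ω hω =>
      sub_le_sub_right (exp_mul_le_one_sub_rpow_neg hβ hb
        (by rw [mul_comm]; exact (lt_div_iff₀ hb).1 hω.2)) 1
    refine MeasureTheory.integral_mono_of_nonneg ?_ (hIoc.mono_set Set.Ioo_subset_Ioc_self) ?_ <;>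
      filter_upwards [MeasureTheory.ae_restrict_mem measurableSet_Ioo] with ω hω
    · exact div_nonneg (pow_nonneg hω.1.le 3) ((hpos ω hω.1).le.trans (hfactor ω hω))
    · exact div_le_div_of_nonneg_left (pow_nonneg hω.1.le 3) (hpos ω hω.1) (hfactor ω hω)
  rw [intervalIntegral.integral_of_le hb'.le, ← Set.Ioc_union_Ioi_eq_Ioi hb'.le,
    MeasureTheory.setIntegral_union (Set.Ioc_disjoint_Ioi le_rfl) measurableSet_Ioi hIoc hIoi]
  linarith
end

section
/- Fix β > 0 and ε > 0. Then lim_{b → 0⁺} (1/b)·[ 1/((1 − b·ε)^{−β/b} − 1) − 1/(e^{β·ε} − 1) ] = −(β·ε²/2)·e^{β·ε}/(e^{β·ε} − 1)², where the exponent β/b is taken as a real power. In particular the first-order-in-b correction to the effective discrete Bose–Einstein occupation is negative for all ε > 0. -/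
open Filter

/-- Second-order Taylor expansion of `log (1 - x)` at `0`, as a right-hand limit. -/
theorem tendsto_log_one_sub_mul_add_div_sq (ε : ℝ) (hε : 0 < ε) :
    Tendsto (fun b : ℝ => (Real.log (1 - b * ε) + b * ε) / b ^ 2)
      (nhdsWithin 0 (Set.Ioi 0)) (nhds (-(ε ^ 2 / 2))) := by
  rw [tendsto_iff_norm_sub_tendsto_zero]
  have hb : Tendsto (fun b : ℝ => b * ε ^ 3 / (1 - b * ε))
      (nhdsWithin 0 (Set.Ioi 0)) (nhds 0) := by
    have : ContinuousAt (fun b : ℝ => b * ε ^ 3 / (1 - b * ε)) 0 := by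
      apply ContinuousAt.div <;> first | fun_prop | simp
    simpa using this.tendsto.mono_left nhdsWithin_le_nhds
  refine squeeze_zero' (Eventually.of_forall fun _ => norm_nonneg _) ?_ hb
  filter_upwards [Ioo_mem_nhdsGT (inv_pos.mpr hε)] with b hb
  have hb0 : 0 < b := hb.1
  have hx : b * ε < 1 := by
    simpa [hε.ne'] using mul_lt_mul_of_pos_right hb.2 hε
  have hx0 : 0 < b * ε := mul_pos hb0 hε
  have h := Real.abs_log_sub_add_sum_range_le (x := b * ε) (by rwa [abs_of_pos hx0]) 2
  rw [abs_of_pos hx0] at h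
  norm_num [Finset.sum_range_succ] at h
  have e : (Real.log (1 - b * ε) + b * ε) / b ^ 2 - -(ε ^ 2 / 2) =
      (b * ε + (b * ε) ^ 2 / 2 + Real.log (1 - b * ε)) / b ^ 2 := by
    field_simp
    ring
  rw [e, Real.norm_eq_abs, abs_div, abs_of_pos (pow_pos hb0 2), div_le_iff₀ (pow_pos hb0 2)]
  refine h.trans_eq ?_
  ring

/-- The exponent `-(β / b) * log (1 - b * ε)`, extended by its limit `β * ε` at `b = 0`, has
right derivative `β * ε ^ 2 / 2` there. -/
theorem hasDerivWithinAt_update_mul_log_one_sub (β ε : ℝ) (hε : 0 < ε) :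
    HasDerivWithinAt
      (Function.update (fun b : ℝ => Real.log (1 - b * ε) * -(β / b)) 0 (β * ε))
      (β * ε ^ 2 / 2) (Set.Ioi 0) 0 := by
  rw [hasDerivWithinAt_iff_tendsto_slope' (by simp)]
  have h := (tendsto_log_one_sub_mul_add_div_sq ε hε).const_mul (-β)
  rw [show -β * -(ε ^ 2 / 2) = β * ε ^ 2 / 2 by ring] at h
  refine h.congr' ?_
  filter_upwards [self_mem_nhdsWithin] with b hb
  have hb0 : b ≠ 0 := ne_of_gt hb
  rw [slope_def_field, Function.update_self, Function.update_of_ne hb0]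
  field_simp
  ring

/-- First-order-in-`b` correction to the effective discrete Bose–Einstein
occupation: it is `-(βε²/2)·e^{βε}/(e^{βε} - 1)²`, negative for all `ε > 0`. -/
theorem discrete_be_occupation_first_order
    (β ε : ℝ) (hβ : 0 < β) (hε : 0 < ε) :
    Tendsto
      (fun b : ℝ =>
        (1 / ((1 - b * ε) ^ (-(β / b)) - 1) - 1 / (Real.exp (β * ε) - 1)) / b)
      (nhdsWithin 0 (Set.Ioi 0))
      (nhds (-(β * ε ^ 2 / 2) * Real.exp (β * ε) / (Real.exp (β * ε) - 1) ^ 2)) := by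
  have hne : Real.exp (β * ε) - 1 ≠ 0 :=
    (sub_pos.mpr (Real.one_lt_exp_iff.mpr (mul_pos hβ hε))).ne'
  have h := ((hasDerivWithinAt_update_mul_log_one_sub β ε hε).exp.sub_const 1).fun_inv
    (by simpa using hne)
  rw [hasDerivWithinAt_iff_tendsto_slope' (by simp)] at h
  simp only [Function.update_self] at h
  rw [show -(β * ε ^ 2 / 2) * Real.exp (β * ε) / (Real.exp (β * ε) - 1) ^ 2 =
    -(Real.exp (β * ε) * (β * ε ^ 2 / 2)) / (Real.exp (β * ε) - 1) ^ 2 by ring]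
  refine h.congr' ?_
  filter_upwards [Ioo_mem_nhdsGT (inv_pos.mpr hε)] with b hb
  have hx : b * ε < 1 := by
    simpa [hε.ne'] using mul_lt_mul_of_pos_right hb.2 hε
  rw [slope_def_field, Function.update_self, Function.update_of_ne hb.1.ne',
    Real.rpow_def_of_pos (sub_pos.mpr hx), sub_zero, one_div, one_div]
end
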